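/- Let 𝔞_{ij}, 𝔟_i, 𝔠_i, 𝔡 be the background linearization coefficients and define the bilinear form 𝔏[(φ,Ψ),(ζ,ω)] = ∫_N Σ_{i=1,2}(𝔞_{ii}∂_iφ + 𝔟_iΨ)∂_iζ + ∇Ψ·∇ω + (𝔠·∇φ + 𝔡Ψ)ω dx. Then there exists a constant ν₃>0, depending only on the data, such that for all ζ, ω ∈ C¹(N̄) with ζ = 0 on Γ₀ and ω = 0 on Γ₀∪Γ_L, one has 𝔏[(ζ,ω),(ζ,ω)] ≥ ∫_N ν₁|∇ζ|² + |∇ω|² + ν₂ω² dx ≥ ν₃ ∫_N (ζ² + |∇ζ|² + ω² + |∇ω|²) dx, where ν₁, ν₂ are the ellipticity and positivity constants of the coefficients. -/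

import Mathlib

open Real Set Metric MeasureTheory
open scoped ENNReal

noncomputable section

abbrev Pt : Type := ℝ × ℝ

/-- partial derivative in the `x₁` direction -/
def pd1 (f : Pt → ℝ) : Pt → ℝ := fun x => fderiv ℝ f x (1, 0)

/-- partial derivative in the `x₂` direction -/
def pd2 (f : Pt → ℝ) : Pt → ℝ := fun x => fderiv ℝ f x (0, 1)

/-- mixed partial derivative `∂₁^i ∂₂^j` -/
def Dmix (i j : ℕ) (f : Pt → ℝ) : Pt → ℝ := pd1^[i] (pd2^[j] f)

/-- Laplacian -/
def lap (f : Pt → ℝ) : Pt → ℝ := fun x => pd1 (pd1 f) x + pd2 (pd2 f) x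

/-- the nozzle `N = (0,L) × (0,1)` -/
def Noz (L : ℝ) : Set Pt := Ioo 0 L ×ˢ Ioo 0 1

/-- the entrance `Γ₀ = {0} × [0,1]` -/
def Gam0 : Set Pt := {0} ×ˢ Icc 0 1

/-- the exit `Γ_L = {L} × [0,1]` -/
def GamL (L : ℝ) : Set Pt := {L} ×ˢ Icc 0 1

/-- the insulated walls `Γ_w = (0,L) × {0,1}` -/
def GamW (L : ℝ) : Set Pt := Ioo 0 L ×ˢ ({0, 1} : Set ℝ)

/-- the closed walls `Γ̄_w = [0,L] × {0,1}` -/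
def GamWbar (L : ℝ) : Set Pt := Icc 0 L ×ˢ ({0, 1} : Set ℝ)

/-- `f` is `C^m` on an open neighborhood of `K` (encoding of "`C^m` up to the boundary") -/
def UpTo (m : ℕ) (f : Pt → ℝ) (K : Set Pt) : Prop :=
  ∃ U : Set Pt, IsOpen U ∧ K ⊆ U ∧ ContDiffOn ℝ m f U

/-! ### Hölder norms (ℝ≥0∞–valued) -/

def supAbs (Ω : Set Pt) (g : Pt → ℝ) : ℝ≥0∞ := ⨆ x ∈ Ω, ENNReal.ofReal |g x|

def hSemi (α : ℝ) (Ω : Set Pt) (g : Pt → ℝ) : ℝ≥0∞ :=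
  ⨆ x ∈ Ω, ⨆ y ∈ Ω, ⨆ _ : x ≠ y, ENNReal.ofReal (|g x - g y| / ‖x - y‖ ^ α)

def idxLe (m : ℕ) : Finset (ℕ × ℕ) :=
  (Finset.range (m+1) ×ˢ Finset.range (m+1)).filter (fun p => p.1 + p.2 ≤ m)

def idxEq (m : ℕ) : Finset (ℕ × ℕ) :=
  (Finset.range (m+1) ×ˢ Finset.range (m+1)).filter (fun p => p.1 + p.2 = m)

/-- the Hölder norm `‖f‖_{m,α,Ω}` -/
def hNorm (m : ℕ) (α : ℝ) (Ω : Set Pt) (f : Pt → ℝ) : ℝ≥0∞ :=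
  ∑ p ∈ idxLe m, supAbs Ω (Dmix p.1 p.2 f) + ∑ p ∈ idxEq m, hSemi α Ω (Dmix p.1 p.2 f)

/-- the `C^k` sup norm `‖f‖_{k,Ω}` -/
def ckNorm (k : ℕ) (Ω : Set Pt) (f : Pt → ℝ) : ℝ≥0∞ :=
  ∑ p ∈ idxLe k, supAbs Ω (Dmix p.1 p.2 f)

def wSup (k : ℝ) (Γ Ω : Set Pt) (d : ℕ) (g : Pt → ℝ) : ℝ≥0∞ :=
  ⨆ x ∈ Ω, ENNReal.ofReal (infDist x Γ ^ (max ((d : ℝ) + k) 0) * |g x|)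

def wSemi (m : ℕ) (α k : ℝ) (Γ Ω : Set Pt) (g : Pt → ℝ) : ℝ≥0∞ :=
  ⨆ x ∈ Ω, ⨆ y ∈ Ω, ⨆ _ : x ≠ y,
    ENNReal.ofReal ((min (infDist x Γ) (infDist y Γ)) ^ (max ((m : ℝ) + α + k) 0) *
      (|g x - g y| / ‖x - y‖ ^ α))

/-- the weighted Hölder norm `‖f‖^{(k,Γ)}_{m,α,Ω}` -/
def whNorm (m : ℕ) (α k : ℝ) (Γ Ω : Set Pt) (f : Pt → ℝ) : ℝ≥0∞ :=
  ∑ p ∈ idxLe m, wSup k Γ Ω (p.1 + p.2) (Dmix p.1 p.2 f)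
  + ∑ p ∈ idxEq m, wSemi m α k Γ Ω (Dmix p.1 p.2 f)

/-! ### one–dimensional versions, for norms of boundary data -/

def supAbs1 (Ω : Set ℝ) (g : ℝ → ℝ) : ℝ≥0∞ := ⨆ x ∈ Ω, ENNReal.ofReal |g x|

def hSemi1 (α : ℝ) (Ω : Set ℝ) (g : ℝ → ℝ) : ℝ≥0∞ :=
  ⨆ x ∈ Ω, ⨆ y ∈ Ω, ⨆ _ : x ≠ y, ENNReal.ofReal (|g x - g y| / |x - y| ^ α)

/-- the one–dimensional Hölder norm `‖f‖_{m,α,Ω}` -/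
def h1Norm (m : ℕ) (α : ℝ) (Ω : Set ℝ) (f : ℝ → ℝ) : ℝ≥0∞ :=
  ∑ i ∈ Finset.range (m+1), supAbs1 Ω (deriv^[i] f) + hSemi1 α Ω (deriv^[m] f)

def wSup1 (k : ℝ) (Γ Ω : Set ℝ) (d : ℕ) (g : ℝ → ℝ) : ℝ≥0∞ :=
  ⨆ x ∈ Ω, ENNReal.ofReal (infDist x Γ ^ (max ((d : ℝ) + k) 0) * |g x|)

def wSemi1 (m : ℕ) (α k : ℝ) (Γ Ω : Set ℝ) (g : ℝ → ℝ) : ℝ≥0∞ :=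
  ⨆ x ∈ Ω, ⨆ y ∈ Ω, ⨆ _ : x ≠ y,
    ENNReal.ofReal ((min (infDist x Γ) (infDist y Γ)) ^ (max ((m : ℝ) + α + k) 0) *
      (|g x - g y| / |x - y| ^ α))

/-- the one–dimensional weighted Hölder norm `‖f‖^{(k,Γ)}_{m,α,Ω}` -/
def wh1Norm (m : ℕ) (α k : ℝ) (Γ Ω : Set ℝ) (f : ℝ → ℝ) : ℝ≥0∞ :=
  ∑ i ∈ Finset.range (m+1), wSup1 k Γ Ω i (deriv^[i] f) + wSemi1 m α k Γ Ω (deriv^[m] f)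

/-! ### gas quantities and the background solution -/

/-- density as a function of entropy `S` and `ζ = K + Φ − |u|²/2` -/
def Hfun (γ 𝔭 cv S ζ : ℝ) : ℝ := ((γ - 1) * ζ / (γ * 𝔭 * exp (S / cv))) ^ (1 / (γ - 1))

/-- temperature -/
def Tfun (γ 𝔭 cv ρ S : ℝ) : ℝ := (cv * 𝔭 / (γ - 1)) * exp (S / cv) * ρ ^ (γ - 1)

/-- the background Bernoulli constant `B₀ = ū(0)²/2 + γ𝔭e^{S₀/c_v}ρ₀^{γ−1}/(γ−1)` -/
def Bern0 (γ 𝔭 cv S₀ J₀ ρ₀ : ℝ) : ℝ :=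
  (J₀ / ρ₀) ^ 2 / 2 + γ * 𝔭 * exp (S₀ / cv) * ρ₀ ^ (γ - 1) / (γ - 1)

/-- the Bernoulli function of a flow `(ρ, u, v, p)` -/
def BernFn (γ : ℝ) (ρ u v p : Pt → ℝ) : Pt → ℝ :=
  fun y => (u y ^ 2 + v y ^ 2) / 2 + γ * p y / ((γ - 1) * ρ y)

/-- the background electric potential `Φ₀` -/
def Phi0 (Eb : ℝ → ℝ) : Pt → ℝ := fun x => ∫ t in (0:ℝ)..x.1, Eb t

/-- the background velocity potential `φ₀` -/
def phi0 (J₀ : ℝ) (ρb : ℝ → ℝ) : Pt → ℝ := fun x => ∫ t in (0:ℝ)..x.1, J₀ / ρb t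

/-- `(ρb, Eb)` is the subsonic background solution of Proposition 2.1 associated with the
data `(b₀, S₀, J₀, ρ₀, E₀, L)`, with density bounds `ρlow, ρhigh` and subsonicity bound `ν₀`. -/
structure Background (γ 𝔭 cv b₀ J₀ S₀ E₀ ρ₀ L ν₀ ρlow ρhigh : ℝ) (ρb Eb : ℝ → ℝ) : Prop where
  hγ : 1 < γ
  h𝔭 : 0 < 𝔭
  hcv : 0 < cv
  hb₀ : 0 < b₀
  hJ₀ : 0 < J₀
  hS₀ : 0 < S₀
  hL : 0 < L
  hν₀ : 0 < ν₀
  hρlow : 0 < ρlow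
  smooth_rho : ContDiffOn ℝ (⊤ : ℕ∞) ρb (Icc 0 L)
  smooth_E : ContDiffOn ℝ (⊤ : ℕ∞) Eb (Icc 0 L)
  init_rho : ρb 0 = ρ₀
  init_E : Eb 0 = E₀
  ode_rho : ∀ x ∈ Icc 0 L, derivWithin ρb (Icc 0 L) x =
      ρb x * Eb x / (γ * 𝔭 * exp (S₀ / cv) * ρb x ^ (γ - 1) - J₀ ^ 2 / ρb x ^ 2)
  ode_E : ∀ x ∈ Icc 0 L, derivWithin Eb (Icc 0 L) x = ρb x - b₀
  bound_lo : ∀ x ∈ Icc 0 L, ρlow ≤ ρb x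
  bound_hi : ∀ x ∈ Icc 0 L, ρb x ≤ ρhigh
  subsonic : ∀ x ∈ Icc 0 L, ν₀ ≤ γ * 𝔭 * exp (S₀ / cv) * ρb x ^ (γ - 1) - J₀ ^ 2 / ρb x ^ 2

/-! ### sizes of the perturbations -/

/-- `ω₁(b) = ‖b − b₀‖_{α,N}` -/
def om1 (α b₀ L : ℝ) (b : Pt → ℝ) : ℝ≥0∞ := hNorm 0 α (Noz L) (fun x => b x - b₀)

/-- `ω₂(S_en, B_en) = ‖(S_en,B_en) − (S₀,B₀)‖_{1,α,Γ₀}` -/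
def om2 (α S₀ B₀ : ℝ) (Sen Ben : ℝ → ℝ) : ℝ≥0∞ :=
  h1Norm 1 α (Icc 0 1) (fun t => Sen t - S₀) + h1Norm 1 α (Icc 0 1) (fun t => Ben t - B₀)

/-- `ω₃(Φ_bd, p_ex)`, where `Φ_bd` is described by its two traces `Φbd0` on `Γ₀` and
`ΦbdL` on `Γ_L` (as functions of `x₂`), and the background potential vanishes on `Γ₀`. -/
def om3 (γ 𝔭 cv S₀ α L : ℝ) (ρb Eb : ℝ → ℝ) (Φbd0 ΦbdL pex : ℝ → ℝ) : ℝ≥0∞ :=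
  wh1Norm 2 α (-1-α) {0, 1} (Icc 0 1) Φbd0
  + wh1Norm 2 α (-1-α) {0, 1} (Icc 0 1) (fun t => ΦbdL t - ∫ s in (0:ℝ)..L, Eb s)
  + wh1Norm 1 α (-α) {0, 1} (Icc 0 1) (fun t => pex t - 𝔭 * exp (S₀ / cv) * ρb L ^ γ)

/-- the `W^{2,μ}` norm on `Γ₀ ≃ [0,1]` -/
def W2mu (μ : ℝ) (f : ℝ → ℝ) : ℝ :=
  (∫ t in (0:ℝ)..1, (|f t| ^ μ + |deriv f t| ^ μ + |deriv (deriv f) t| ^ μ)) ^ (1 / μ)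

/-- `ω₄(S_en, B_en, Φ_bd) = ‖(S_en, B_en − Φ_bd) − (S₀, B₀)‖_{W^{2,μ}(Γ₀)}` -/
def om4 (μ S₀ B₀ : ℝ) (Sen Ben Φbd0 : ℝ → ℝ) : ℝ :=
  W2mu μ (fun t => Sen t - S₀) + W2mu μ (fun t => Ben t - Φbd0 t - B₀)

/-! ### the nonlinear fluxes and their linearization at the background state -/

def evec : Fin 2 → Pt := fun j => if j = 0 then (1, 0) else (0, 1)

/-- the flux `B(ς,η,z,q,s) = H(ς, η + z − |q + s^⊥|²/2)`, `s^⊥ = (s₂,−s₁)` -/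
def Bflux (γ 𝔭 cv ς η z : ℝ) (q s : Pt) : ℝ :=
  Hfun γ 𝔭 cv ς (η + z - ((q.1 + s.2) ^ 2 + (q.2 - s.1) ^ 2) / 2)

/-- the flux `A_i(ς,η,z,q,s) = B(ς,η,z,q,s)·q_i` -/
def Aflux (γ 𝔭 cv : ℝ) (i : Fin 2) (ς η z : ℝ) (q s : Pt) : ℝ :=
  Bflux γ 𝔭 cv ς η z q s * (if i = 0 then q.1 else q.2)

/-- `𝔞_{ij}(x) = ∂_{q_j}A_i(V₀(x))` at the background state
`V₀(x) = (S₀, K₀, Φ₀(x), (ū(x₁),0), 0)` -/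
def coefa (γ 𝔭 cv S₀ K₀ J₀ : ℝ) (ρb Eb : ℝ → ℝ) (i j : Fin 2) (x : Pt) : ℝ :=
  deriv (fun t : ℝ => Aflux γ 𝔭 cv i S₀ K₀ (Phi0 Eb x) ((J₀ / ρb x.1, 0) + t • evec j) (0, 0)) 0

/-- `𝔟_i(x) = ∂_z A_i(V₀(x))` -/
def coefb (γ 𝔭 cv S₀ K₀ J₀ : ℝ) (ρb Eb : ℝ → ℝ) (i : Fin 2) (x : Pt) : ℝ :=
  deriv (fun t : ℝ => Aflux γ 𝔭 cv i S₀ K₀ (Phi0 Eb x + t) (J₀ / ρb x.1, 0) (0, 0)) 0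

/-- `𝔠_i(x) = ∂_{q_i}B(V₀(x))` -/
def coefc (γ 𝔭 cv S₀ K₀ J₀ : ℝ) (ρb Eb : ℝ → ℝ) (i : Fin 2) (x : Pt) : ℝ :=
  deriv (fun t : ℝ => Bflux γ 𝔭 cv S₀ K₀ (Phi0 Eb x) ((J₀ / ρb x.1, 0) + t • evec i) (0, 0)) 0

/-- `𝔡(x) = ∂_z B(V₀(x))` -/
def coefd (γ 𝔭 cv S₀ K₀ J₀ : ℝ) (ρb Eb : ℝ → ℝ) (x : Pt) : ℝ :=
  deriv (fun t : ℝ => Bflux γ 𝔭 cv S₀ K₀ (Phi0 Eb x + t) (J₀ / ρb x.1, 0) (0, 0)) 0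

/-- The derivative of `Hfun` in its last argument. -/
def HfunDeriv (γ 𝔭 cv S ζ : ℝ) : ℝ :=
  (γ - 1) / (γ * 𝔭 * exp (S / cv)) * (1 / (γ - 1)) *
    ((γ - 1) * ζ / (γ * 𝔭 * exp (S / cv))) ^ (1 / (γ - 1) - 1)

/-- The background enthalpy `γ𝔭e^{S₀/c_v}ρ^{γ-1}/(γ-1)`. -/
def bgEnthalpy (γ 𝔭 cv S₀ : ℝ) (ρb : ℝ → ℝ) (s : ℝ) : ℝ :=
  γ * 𝔭 * exp (S₀ / cv) * ρb s ^ (γ - 1) / (γ - 1)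

theorem hasDerivAt_Hfun {γ 𝔭 cv S ζ : ℝ} (hγ : 1 < γ) (h𝔭 : 0 < 𝔭) (hζ : 0 < ζ) :
    HasDerivAt (Hfun γ 𝔭 cv S) (HfunDeriv γ 𝔭 cv S ζ) ζ := by
  have hγ' : 0 < γ - 1 := sub_pos.2 hγ
  have hlin : HasDerivAt (fun z : ℝ => (γ - 1) * z / (γ * 𝔭 * exp (S / cv)))
      ((γ - 1) / (γ * 𝔭 * exp (S / cv))) ζ := by
    simpa using ((hasDerivAt_id ζ).const_mul (γ - 1)).div_const (γ * 𝔭 * exp (S / cv))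
  exact hlin.rpow_const (Or.inl (by positivity))

theorem closure_Noz {L : ℝ} (hL : 0 < L) : closure (Noz L) = Icc 0 L ×ˢ Icc 0 1 := by
  rw [Noz, closure_prod_eq, closure_Ioo hL.ne, closure_Ioo zero_ne_one]

theorem Noz_subset (L : ℝ) : Noz L ⊆ Icc 0 L ×ˢ Icc 0 1 :=
  prod_mono Ioo_subset_Icc_self Ioo_subset_Icc_self

theorem measurableSet_Noz (L : ℝ) : MeasurableSet (Noz L) :=
  measurableSet_Ioo.prod measurableSet_Ioo

theorem integrableOn_Noz {L : ℝ} {f : Pt → ℝ} (hf : ContinuousOn f (Icc 0 L ×ˢ Icc 0 1)) :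
    IntegrableOn f (Noz L) :=
  (hf.integrableOn_compact (isCompact_Icc.prod isCompact_Icc)).mono_set (Noz_subset L)

namespace Background

variable {γ 𝔭 cv b₀ J₀ S₀ E₀ ρ₀ L ν₀ ρlow ρhigh : ℝ} {ρb Eb : ℝ → ℝ}

theorem rho_pos (hbg : Background γ 𝔭 cv b₀ J₀ S₀ E₀ ρ₀ L ν₀ ρlow ρhigh ρb Eb)
    {s : ℝ} (hs : s ∈ Icc 0 L) : 0 < ρb s :=
  hbg.hρlow.trans_le (hbg.bound_lo s hs)

theorem bgEnthalpy_pos (hbg : Background γ 𝔭 cv b₀ J₀ S₀ E₀ ρ₀ L ν₀ ρlow ρhigh ρb Eb)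
    {s : ℝ} (hs : s ∈ Icc 0 L) : 0 < bgEnthalpy γ 𝔭 cv S₀ ρb s := by
  have := hbg.rho_pos hs
  have := hbg.h𝔭
  have := sub_pos.2 hbg.hγ
  have : 0 < γ := by linarith
  unfold bgEnthalpy
  positivity

theorem continuousOn_bgEnthalpy
    (hbg : Background γ 𝔭 cv b₀ J₀ S₀ E₀ ρ₀ L ν₀ ρlow ρhigh ρb Eb) :
    ContinuousOn (bgEnthalpy γ 𝔭 cv S₀ ρb) (Icc 0 L) :=
  ((hbg.smooth_rho.continuousOn.rpow_const
    fun _ hs => Or.inl (hbg.rho_pos hs).ne').const_mul _).div_const _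

/-- Bernoulli's law for the background flow. -/
theorem bernoulli (hbg : Background γ 𝔭 cv b₀ J₀ S₀ E₀ ρ₀ L ν₀ ρlow ρhigh ρb Eb)
    {s : ℝ} (hs : s ∈ Icc 0 L) :
    Bern0 γ 𝔭 cv S₀ J₀ ρ₀ + (∫ t in (0:ℝ)..s, Eb t) - (J₀ / ρb s) ^ 2 / 2 =
      bgEnthalpy γ 𝔭 cv S₀ ρb s := by
  have hγ' : 0 < γ - 1 := sub_pos.2 hbg.hγ
  have hderiv : ∀ x ∈ Icc 0 L, HasDerivWithinAt
      (fun s => (∫ t in (0:ℝ)..s, Eb t) - (J₀ / ρb s) ^ 2 / 2 - bgEnthalpy γ 𝔭 cv S₀ ρb s)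
      0 (Icc 0 L) x := by
    intro x hx
    have hρ := hbg.rho_pos hx
    have hEc := hbg.smooth_E.continuousOn
    have hΦ : HasDerivWithinAt (fun s => ∫ t in (0:ℝ)..s, Eb t) (Eb x) (Icc 0 L) x := by
      have : Fact (x ∈ Icc 0 L) := ⟨hx⟩
      refine intervalIntegral.integral_hasDerivWithinAt_right
        ((hEc.mono ?_).intervalIntegrable)
        (hEc.stronglyMeasurableAtFilter_nhdsWithin measurableSet_Icc x) (hEc x hx)
      rw [uIcc_of_le hx.1]
      exact Icc_subset_Icc_right hx.2
    have hr : HasDerivWithinAt ρb (ρb x * Eb x /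
        (γ * 𝔭 * exp (S₀ / cv) * ρb x ^ (γ - 1) - J₀ ^ 2 / ρb x ^ 2)) (Icc 0 L) x := by
      rw [← hbg.ode_rho x hx]
      exact (hbg.smooth_rho.differentiableOn (by simp) x hx).hasDerivWithinAt
    have hu := ((hr.fun_inv hρ.ne').const_mul J₀)
    have hh := ((hr.rpow_const (p := γ - 1) (Or.inl hρ.ne')).const_mul
      (γ * 𝔭 * exp (S₀ / cv))).div_const (γ - 1)
    have hall := (hΦ.sub ((hu.pow 2).div_const 2)).sub hh
    refine hall.congr_deriv ?_
    have hsub := (hbg.hν₀.trans_le (hbg.subsonic x hx)).ne'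
    rw [rpow_sub_one hρ.ne' (γ - 1)]
    simp only [Nat.cast_ofNat, Nat.add_one_sub_one, pow_one]
    have hr' := div_mul_cancel₀ (ρb x * Eb x) hsub
    generalize ρb x * Eb x /
      (γ * 𝔭 * exp (S₀ / cv) * ρb x ^ (γ - 1) - J₀ ^ 2 / ρb x ^ 2) = r at hr' ⊢
    have hE : Eb x =
        r * (γ * 𝔭 * exp (S₀ / cv) * ρb x ^ (γ - 1) - J₀ ^ 2 / ρb x ^ 2) / ρb x := by
      rw [hr', mul_div_cancel_left₀ _ hρ.ne']
    rw [hE]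
    field_simp
    ring
  have hconst := constant_of_derivWithin_zero
    (fun x hx => (hderiv x hx).differentiableWithinAt)
    (fun x hx => (hderiv x (Ico_subset_Icc_self hx)).derivWithin
      (uniqueDiffOn_Icc hbg.hL x (Ico_subset_Icc_self hx))) s hs
  simp only [intervalIntegral.integral_same, hbg.init_rho, bgEnthalpy] at hconst
  unfold Bern0 bgEnthalpy
  linarith

theorem coefd_eq (hbg : Background γ 𝔭 cv b₀ J₀ S₀ E₀ ρ₀ L ν₀ ρlow ρhigh ρb Eb)
    {x : Pt} (hx : x.1 ∈ Icc 0 L) :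
    coefd γ 𝔭 cv S₀ (Bern0 γ 𝔭 cv S₀ J₀ ρ₀) J₀ ρb Eb x =
      HfunDeriv γ 𝔭 cv S₀ (bgEnthalpy γ 𝔭 cv S₀ ρb x.1) := by
  have hH := hasDerivAt_Hfun (cv := cv) (S := S₀) hbg.hγ hbg.h𝔭 (hbg.bgEnthalpy_pos hx)
  have hin : HasDerivAt (fun t : ℝ => bgEnthalpy γ 𝔭 cv S₀ ρb x.1 + t) 1 0 :=
    (hasDerivAt_id 0).const_add _
  have hcomp := HasDerivAt.comp (h₂ := Hfun γ 𝔭 cv S₀) (0:ℝ) (by simpa using hH) hin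
  rw [mul_one] at hcomp
  refine Eq.trans ?_ hcomp.deriv
  unfold coefd
  congr 1
  funext t
  simp only [Bflux, Phi0, Function.comp, ← hbg.bernoulli hx]
  congr 1
  ring

theorem coefa_zero_zero_eq
    (hbg : Background γ 𝔭 cv b₀ J₀ S₀ E₀ ρ₀ L ν₀ ρlow ρhigh ρb Eb)
    {x : Pt} (hx : x.1 ∈ Icc 0 L) :
    coefa γ 𝔭 cv S₀ (Bern0 γ 𝔭 cv S₀ J₀ ρ₀) J₀ ρb Eb 0 0 x =
      Hfun γ 𝔭 cv S₀ (bgEnthalpy γ 𝔭 cv S₀ ρb x.1) -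
        HfunDeriv γ 𝔭 cv S₀ (bgEnthalpy γ 𝔭 cv S₀ ρb x.1) * (J₀ / ρb x.1) ^ 2 := by
  have hH := hasDerivAt_Hfun (cv := cv) (S := S₀) hbg.hγ hbg.h𝔭 (hbg.bgEnthalpy_pos hx)
  set u := J₀ / ρb x.1 with hu
  have hq : HasDerivAt (fun t : ℝ => u + t) 1 0 := (hasDerivAt_id 0).const_add _
  have hin : HasDerivAt
      (fun t : ℝ => bgEnthalpy γ 𝔭 cv S₀ ρb x.1 + (u ^ 2 / 2 - (u + t) ^ 2 / 2)) (-u) 0 := by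
    refine ((((hq.pow 2).div_const 2).const_sub _).const_add _).congr_deriv ?_
    simp
  have hcomp := (HasDerivAt.comp (h₂ := Hfun γ 𝔭 cv S₀) (0:ℝ) (by simpa using hH) hin).mul hq
  refine Eq.trans ?_ (hcomp.deriv.trans ?_)
  · unfold coefa
    congr 1
    funext t
    simp only [Aflux, Bflux, Phi0, evec, ← hbg.bernoulli hx, Pi.mul_apply, Function.comp, ← hu]
    simp
  · simp
    ring

theorem coefa_one_one_eq
    (hbg : Background γ 𝔭 cv b₀ J₀ S₀ E₀ ρ₀ L ν₀ ρlow ρhigh ρb Eb)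
    {x : Pt} (hx : x.1 ∈ Icc 0 L) :
    coefa γ 𝔭 cv S₀ (Bern0 γ 𝔭 cv S₀ J₀ ρ₀) J₀ ρb Eb 1 1 x =
      Hfun γ 𝔭 cv S₀ (bgEnthalpy γ 𝔭 cv S₀ ρb x.1) := by
  have hH := hasDerivAt_Hfun (cv := cv) (S := S₀) hbg.hγ hbg.h𝔭 (hbg.bgEnthalpy_pos hx)
  have hin : HasDerivAt
      (fun t : ℝ => bgEnthalpy γ 𝔭 cv S₀ ρb x.1 - t ^ 2 / 2) 0 0 := by
    refine ((((hasDerivAt_id (0:ℝ)).pow 2).div_const 2).const_sub _).congr_deriv ?_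
    simp
  have hcomp := (HasDerivAt.comp (h₂ := Hfun γ 𝔭 cv S₀) (0:ℝ) (by simpa using hH) hin).mul
    (hasDerivAt_id (0:ℝ))
  refine Eq.trans ?_ (hcomp.deriv.trans ?_)
  · unfold coefa
    congr 1
    funext t
    simp only [Aflux, Bflux, Phi0, evec, ← hbg.bernoulli hx, Pi.mul_apply, Function.comp]
    simp
    left
    congr 1
    ring
  · simp

theorem continuousOn_Hfun_bgEnthalpy
    (hbg : Background γ 𝔭 cv b₀ J₀ S₀ E₀ ρ₀ L ν₀ ρlow ρhigh ρb Eb) :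
    ContinuousOn (fun s => Hfun γ 𝔭 cv S₀ (bgEnthalpy γ 𝔭 cv S₀ ρb s)) (Icc 0 L) := by
  intro s hs
  exact (hasDerivAt_Hfun hbg.hγ hbg.h𝔭 (hbg.bgEnthalpy_pos hs)).continuousAt
    |>.comp_continuousWithinAt (hbg.continuousOn_bgEnthalpy s hs)

theorem continuousOn_HfunDeriv_bgEnthalpy
    (hbg : Background γ 𝔭 cv b₀ J₀ S₀ E₀ ρ₀ L ν₀ ρlow ρhigh ρb Eb) :
    ContinuousOn (fun s => HfunDeriv γ 𝔭 cv S₀ (bgEnthalpy γ 𝔭 cv S₀ ρb s)) (Icc 0 L) := by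
  refine continuousOn_const.mul (((hbg.continuousOn_bgEnthalpy.const_mul _).div_const _).rpow_const
    fun s hs => Or.inl ?_)
  have := hbg.bgEnthalpy_pos hs
  have := hbg.h𝔭
  have := sub_pos.2 hbg.hγ
  have : 0 < γ := by linarith
  positivity

end Background

section UpTo

variable {f : Pt → ℝ} {K : Set Pt}

theorem UpTo.continuousOn (hf : UpTo 1 f K) : ContinuousOn f K := by
  obtain ⟨U, -, hKU, hfU⟩ := hf
  exact hfU.continuousOn.mono hKU

theorem UpTo.continuousOn_fderiv (hf : UpTo 1 f K) : ContinuousOn (fderiv ℝ f) K := by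
  obtain ⟨U, hU, hKU, hfU⟩ := hf
  exact (hfU.continuousOn_fderiv_of_isOpen hU (by simp)).mono hKU

theorem UpTo.continuousOn_pd1 (hf : UpTo 1 f K) : ContinuousOn (pd1 f) K :=
  hf.continuousOn_fderiv.clm_apply continuousOn_const

theorem UpTo.continuousOn_pd2 (hf : UpTo 1 f K) : ContinuousOn (pd2 f) K :=
  hf.continuousOn_fderiv.clm_apply continuousOn_const

theorem UpTo.hasDerivAt_fst (hf : UpTo 1 f K) {s t : ℝ} (hst : (s, t) ∈ K) :
    HasDerivAt (fun r => f (r, t)) (pd1 f (s, t)) s := by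
  obtain ⟨U, hU, hKU, hfU⟩ := hf
  have hd : HasFDerivAt f (fderiv ℝ f (s, t)) (s, t) :=
    ((hfU.differentiableOn (by simp)).differentiableAt (hU.mem_nhds (hKU hst))).hasFDerivAt
  exact hd.comp_hasDerivAt s ((hasDerivAt_id s).prodMk (hasDerivAt_const s t))

end UpTo

/-- A `C¹` function vanishing at `0` is bounded pointwise by the `L²` norm of its derivative. -/
theorem sq_le_mul_integral_deriv_sq {L s : ℝ} {f f' : ℝ → ℝ} (hs : s ∈ Ioc 0 L)
    (hf : ∀ r ∈ Icc 0 L, HasDerivAt f (f' r) r) (hf' : ContinuousOn f' (Icc 0 L))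
    (h0 : f 0 = 0) : f s ^ 2 ≤ L * ∫ r in (0:ℝ)..L, f' r ^ 2 := by
  have hs0 : 0 < s := hs.1
  have hc : ContinuousOn f' (uIcc 0 s) := by
    rw [uIcc_of_le hs0.le]
    exact hf'.mono (Icc_subset_Icc_right hs.2)
  have hc2 : ContinuousOn f' (uIcc s L) := by
    rw [uIcc_of_le hs.2]
    exact hf'.mono (Icc_subset_Icc_left hs0.le)
  have hftc : ∫ r in (0:ℝ)..s, f' r = f s := by
    rw [intervalIntegral.integral_eq_sub_of_hasDerivAt (f := f) _ hc.intervalIntegrable, h0, sub_zero]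
    intro r hr
    rw [uIcc_of_le hs0.le] at hr
    exact hf r ⟨hr.1, hr.2.trans hs.2⟩
  have hi2 : IntervalIntegrable (fun r => f' r ^ 2) volume 0 s := (hc.pow 2).intervalIntegrable
  have hnn : 0 ≤ ∫ r in (0:ℝ)..s, (s * f' r - f s) ^ 2 :=
    intervalIntegral.integral_nonneg hs0.le fun _ _ => sq_nonneg _
  have hexp : ∫ r in (0:ℝ)..s, (s * f' r - f s) ^ 2 =
      s * (s * (∫ r in (0:ℝ)..s, f' r ^ 2) - f s ^ 2) := by
    have : ∀ r, (s * f' r - f s) ^ 2 = s ^ 2 * f' r ^ 2 - 2 * s * f s * f' r + f s ^ 2 :=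
      fun r => by ring
    simp only [this]
    rw [intervalIntegral.integral_add ((hi2.const_mul _).sub (hc.intervalIntegrable.const_mul _))
        intervalIntegrable_const,
      intervalIntegral.integral_sub (hi2.const_mul _) (hc.intervalIntegrable.const_mul _),
      intervalIntegral.integral_const_mul, intervalIntegral.integral_const_mul, hftc,
      intervalIntegral.integral_const, smul_eq_mul]
    ring
  have hle : f s ^ 2 ≤ s * ∫ r in (0:ℝ)..s, f' r ^ 2 := by
    rw [hexp] at hnn
    linarith [nonneg_of_mul_nonneg_right hnn hs0]
  have hsplit := intervalIntegral.integral_add_adjacent_intervals hi2 (hc2.pow 2).intervalIntegrable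
  have h1 : 0 ≤ ∫ r in (0:ℝ)..s, f' r ^ 2 :=
    intervalIntegral.integral_nonneg hs0.le fun _ _ => sq_nonneg _
  have h2 : 0 ≤ ∫ r in s..L, f' r ^ 2 :=
    intervalIntegral.integral_nonneg hs.2 fun _ _ => sq_nonneg _
  rw [← hsplit]
  exact hle.trans (mul_le_mul hs.2 (le_add_of_nonneg_right h2) h1 (hs0.le.trans hs.2))

theorem setIntegral_Noz_eq {L : ℝ} {g : Pt → ℝ} (hg : IntegrableOn g (Noz L)) :
    ∫ x in Noz L, g x = ∫ t in Ioo (0:ℝ) 1, ∫ s in Ioo 0 L, g (s, t) := by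
  rw [IntegrableOn, Noz, Measure.volume_eq_prod, ← Measure.prod_restrict] at hg
  rw [Noz, Measure.volume_eq_prod, ← Measure.prod_restrict]
  exact integral_prod_symm g hg

/-- Poincaré inequality on the nozzle for functions vanishing at the entrance. -/
theorem poincare_Noz {L : ℝ} (hL : 0 < L) {f : Pt → ℝ} (hf : UpTo 1 f (closure (Noz L)))
    (h0 : ∀ t ∈ Icc (0:ℝ) 1, f (0, t) = 0) :
    ∫ x in Noz L, f x ^ 2 ≤ L ^ 2 * ∫ x in Noz L, pd1 f x ^ 2 := by
  rw [closure_Noz hL] at hf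
  have hc := hf.continuousOn
  have hc1 := hf.continuousOn_pd1
  have hif : IntegrableOn (fun x => f x ^ 2) (Noz L) := integrableOn_Noz (hc.pow 2)
  have hip : IntegrableOn (fun x => L ^ 2 * pd1 f x ^ 2) (Noz L) :=
    integrableOn_Noz ((hc1.pow 2).const_mul _)
  have hif' := hif
  have hip' := hip
  rw [IntegrableOn, Noz, Measure.volume_eq_prod, ← Measure.prod_restrict] at hif' hip'
  rw [← integral_const_mul, setIntegral_Noz_eq hif, setIntegral_Noz_eq hip]
  refine setIntegral_mono_on hif'.integral_prod_right hip'.integral_prod_right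
    measurableSet_Ioo fun t ht => ?_
  have ht' : t ∈ Icc (0:ℝ) 1 := Ioo_subset_Icc_self ht
  have hsec : ContinuousOn (fun s => pd1 f (s, t)) (Icc 0 L) :=
    hc1.comp (by fun_prop) fun s hs => ⟨hs, ht'⟩
  have hsecf : ContinuousOn (fun s => f (s, t)) (Icc 0 L) :=
    hc.comp (by fun_prop) fun s hs => ⟨hs, ht'⟩
  have hbound : ∀ s ∈ Ioo 0 L, f (s, t) ^ 2 ≤ L * ∫ r in (0:ℝ)..L, pd1 f (r, t) ^ 2 := fun s hs =>
    sq_le_mul_integral_deriv_sq (f := fun r => f (r, t)) ⟨hs.1, hs.2.le⟩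
      (fun r hr => hf.hasDerivAt_fst ⟨hr, ht'⟩) hsec (h0 t ht')
  have hint : IntegrableOn (fun s => f (s, t) ^ 2) (Ioo 0 L) :=
    ((hsecf.pow 2).integrableOn_compact isCompact_Icc).mono_set Ioo_subset_Icc_self
  have hmono := setIntegral_mono_on hint
    (integrableOn_const (by simp)) measurableSet_Ioo hbound
  refine hmono.trans_eq ?_
  rw [setIntegral_const, integral_const_mul, intervalIntegral.integral_of_le hL.le,
    integral_Ioc_eq_integral_Ioo, Measure.real, Real.volume_Ioo, sub_zero,
    ENNReal.toReal_ofReal hL.le, smul_eq_mul]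
  ring

/-- coercivity of the bilinear form `𝔏`. Let `𝔞_{ij}, 𝔟_i, 𝔠_i, 𝔡` be
the background linearization coefficients, satisfying: `[𝔞_{ij}]` diagonal with
`ν₁I₂ ≤ [𝔞_{ij}] ≤ ν₁⁻¹I₂`, `𝔟_i + 𝔠_i = 0`, and `𝔡 ≥ ν₂ > 0` on `N`. Then there is
`ν₃ > 0`, depending only on the data, such that for all `ζ, ω ∈ C¹(N̄)` with `ζ = 0` on
`Γ₀` and `ω = 0` on `Γ₀ ∪ Γ_L`,
`𝔏[(ζ,ω),(ζ,ω)] ≥ ∫_N ν₁|∇ζ|² + |∇ω|² + ν₂ω² ≥ ν₃∫_N ζ² + |∇ζ|² + ω² + |∇ω|²`. -/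
theorem stmt18 (γ 𝔭 cv b₀ J₀ S₀ E₀ ρ₀ L ν₀ ρlow ρhigh K₀ ν₁ ν₂ : ℝ) (ρb Eb : ℝ → ℝ)
    (hbg : Background γ 𝔭 cv b₀ J₀ S₀ E₀ ρ₀ L ν₀ ρlow ρhigh ρb Eb)
    (hK₀ : K₀ = Bern0 γ 𝔭 cv S₀ J₀ ρ₀)
    (hν₁ : 0 < ν₁) (hν₂ : 0 < ν₂)
    -- `[𝔞_{ij}]` is diagonal with `ν₁ I₂ ≤ [𝔞_{ij}] ≤ ν₁⁻¹ I₂`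
    (hdiag : ∀ x ∈ Noz L,
      coefa γ 𝔭 cv S₀ K₀ J₀ ρb Eb 0 1 x = 0 ∧ coefa γ 𝔭 cv S₀ K₀ J₀ ρb Eb 1 0 x = 0)
    (hell : ∀ x ∈ Noz L, ∀ i : Fin 2,
      ν₁ ≤ coefa γ 𝔭 cv S₀ K₀ J₀ ρb Eb i i x ∧ coefa γ 𝔭 cv S₀ K₀ J₀ ρb Eb i i x ≤ ν₁⁻¹)
    -- the cancellation `𝔟_i + 𝔠_i = 0`
    (hcancel : ∀ x ∈ Noz L, ∀ i : Fin 2,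
      coefb γ 𝔭 cv S₀ K₀ J₀ ρb Eb i x + coefc γ 𝔭 cv S₀ K₀ J₀ ρb Eb i x = 0)
    -- the positivity `𝔡 ≥ ν₂`
    (hd : ∀ x ∈ Noz L, ν₂ ≤ coefd γ 𝔭 cv S₀ K₀ J₀ ρb Eb x) :
    ∃ ν₃ > (0:ℝ), ∀ ζ ω : Pt → ℝ,
      UpTo 1 ζ (closure (Noz L)) → UpTo 1 ω (closure (Noz L)) →
      (∀ t ∈ Icc (0:ℝ) 1, ζ (0, t) = 0) →
      (∀ t ∈ Icc (0:ℝ) 1, ω (0, t) = 0 ∧ ω (L, t) = 0) →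
      (∫ x in Noz L,
          ((coefa γ 𝔭 cv S₀ K₀ J₀ ρb Eb 0 0 x * pd1 ζ x
              + coefb γ 𝔭 cv S₀ K₀ J₀ ρb Eb 0 x * ω x) * pd1 ζ x
            + (coefa γ 𝔭 cv S₀ K₀ J₀ ρb Eb 1 1 x * pd2 ζ x
              + coefb γ 𝔭 cv S₀ K₀ J₀ ρb Eb 1 x * ω x) * pd2 ζ x
            + (pd1 ω x ^ 2 + pd2 ω x ^ 2)
            + (coefc γ 𝔭 cv S₀ K₀ J₀ ρb Eb 0 x * pd1 ζ x
              + coefc γ 𝔭 cv S₀ K₀ J₀ ρb Eb 1 x * pd2 ζ x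
              + coefd γ 𝔭 cv S₀ K₀ J₀ ρb Eb x * ω x) * ω x)
        ≥ ∫ x in Noz L,
            (ν₁ * (pd1 ζ x ^ 2 + pd2 ζ x ^ 2) + (pd1 ω x ^ 2 + pd2 ω x ^ 2)
              + ν₂ * ω x ^ 2)) ∧
      (∫ x in Noz L,
          (ν₁ * (pd1 ζ x ^ 2 + pd2 ζ x ^ 2) + (pd1 ω x ^ 2 + pd2 ω x ^ 2)
            + ν₂ * ω x ^ 2)
        ≥ ν₃ * ∫ x in Noz L,
            (ζ x ^ 2 + pd1 ζ x ^ 2 + pd2 ζ x ^ 2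
              + ω x ^ 2 + pd1 ω x ^ 2 + pd2 ω x ^ 2)) := by
  subst hK₀
  have hL := hbg.hL
  refine ⟨min (min 1 ν₂) (ν₁ / (L ^ 2 + 1)), by positivity, fun ζ ω hζ hω hζ0 _ => ?_⟩
  have hpoin := poincare_Noz hL hζ hζ0
  rw [closure_Noz hL] at hζ hω
  have hζc := hζ.continuousOn
  have hζ1 := hζ.continuousOn_pd1
  have hζ2 := hζ.continuousOn_pd2
  have hωc := hω.continuousOn
  have hω1 := hω.continuousOn_pd1
  have hω2 := hω.continuousOn_pd2
  have hmid : IntegrableOn (fun x => ν₁ * (pd1 ζ x ^ 2 + pd2 ζ x ^ 2)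
      + (pd1 ω x ^ 2 + pd2 ω x ^ 2) + ν₂ * ω x ^ 2) (Noz L) :=
    integrableOn_Noz (by fun_prop)
  constructor
  · have hfst : MapsTo Prod.fst (Icc 0 L ×ˢ Icc (0:ℝ) 1) (Icc 0 L) := fun _ hx => hx.1
    have hρc : ContinuousOn (fun x : Pt => ρb x.1) (Icc 0 L ×ˢ Icc 0 1) :=
      hbg.smooth_rho.continuousOn.comp continuousOn_fst hfst
    have hHc : ContinuousOn (fun x : Pt => Hfun γ 𝔭 cv S₀ (bgEnthalpy γ 𝔭 cv S₀ ρb x.1))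
        (Icc 0 L ×ˢ Icc 0 1) :=
      hbg.continuousOn_Hfun_bgEnthalpy.comp continuousOn_fst hfst
    have hDc : ContinuousOn (fun x : Pt => HfunDeriv γ 𝔭 cv S₀ (bgEnthalpy γ 𝔭 cv S₀ ρb x.1))
        (Icc 0 L ×ˢ Icc 0 1) :=
      hbg.continuousOn_HfunDeriv_bgEnthalpy.comp continuousOn_fst hfst
    have huc : ContinuousOn (fun x : Pt => J₀ / ρb x.1) (Icc 0 L ×ˢ Icc 0 1) :=
      continuousOn_const.div hρc fun x hx => (hbg.rho_pos hx.1).ne'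
    have hform : IntegrableOn (fun x =>
        (Hfun γ 𝔭 cv S₀ (bgEnthalpy γ 𝔭 cv S₀ ρb x.1) -
          HfunDeriv γ 𝔭 cv S₀ (bgEnthalpy γ 𝔭 cv S₀ ρb x.1) * (J₀ / ρb x.1) ^ 2) * pd1 ζ x ^ 2
        + Hfun γ 𝔭 cv S₀ (bgEnthalpy γ 𝔭 cv S₀ ρb x.1) * pd2 ζ x ^ 2
        + (pd1 ω x ^ 2 + pd2 ω x ^ 2)
        + HfunDeriv γ 𝔭 cv S₀ (bgEnthalpy γ 𝔭 cv S₀ ρb x.1) * ω x ^ 2) (Noz L) :=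
      integrableOn_Noz (by fun_prop)
    refine setIntegral_mono_on hmid (hform.congr_fun (fun x hx => ?_) (measurableSet_Noz L))
      (measurableSet_Noz L) fun x hx => ?_
    · have hx1 := (Noz_subset L hx).1
      have hc0 := eq_neg_of_add_eq_zero_right (hcancel x hx 0)
      have hc1 := eq_neg_of_add_eq_zero_right (hcancel x hx 1)
      simp only [hc0, hc1, hbg.coefa_zero_zero_eq hx1, hbg.coefa_one_one_eq hx1,
        hbg.coefd_eq hx1]
      ring
    · have hc0 := eq_neg_of_add_eq_zero_right (hcancel x hx 0)
      have hc1 := eq_neg_of_add_eq_zero_right (hcancel x hx 1)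
      rw [hc0, hc1]
      nlinarith [mul_le_mul_of_nonneg_right (hell x hx 0).1 (sq_nonneg (pd1 ζ x)),
        mul_le_mul_of_nonneg_right (hell x hx 1).1 (sq_nonneg (pd2 ζ x)),
        mul_le_mul_of_nonneg_right (hd x hx) (sq_nonneg (ω x))]
  · set ν₃ := min (min 1 ν₂) (ν₁ / (L ^ 2 + 1))
    have hν₃ : 0 ≤ ν₃ := by positivity
    have hν₃1 : ν₃ ≤ 1 := (min_le_left _ _).trans (min_le_left _ _)
    have hν₃2 : ν₃ ≤ ν₂ := (min_le_left _ _).trans (min_le_right _ _)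
    have hν₃3 : ν₃ * (L ^ 2 + 1) ≤ ν₁ := (le_div_iff₀ (by positivity)).1 (min_le_right _ _)
    have hiζ : IntegrableOn (fun x => ζ x ^ 2) (Noz L) := integrableOn_Noz (hζc.pow 2)
    have hip : IntegrableOn (fun x => pd1 ζ x ^ 2) (Noz L) := integrableOn_Noz (hζ1.pow 2)
    have hirest : IntegrableOn (fun x => pd1 ζ x ^ 2 + pd2 ζ x ^ 2
        + ω x ^ 2 + pd1 ω x ^ 2 + pd2 ω x ^ 2) (Noz L) := integrableOn_Noz (by fun_prop)
    calc ν₃ * ∫ x in Noz L, (ζ x ^ 2 + pd1 ζ x ^ 2 + pd2 ζ x ^ 2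
              + ω x ^ 2 + pd1 ω x ^ 2 + pd2 ω x ^ 2)
        = ν₃ * ((∫ x in Noz L, ζ x ^ 2) + ∫ x in Noz L, (pd1 ζ x ^ 2 + pd2 ζ x ^ 2
              + ω x ^ 2 + pd1 ω x ^ 2 + pd2 ω x ^ 2)) := by
          rw [← integral_add hiζ hirest]
          simp only [add_assoc]
      _ ≤ ν₃ * (L ^ 2 * (∫ x in Noz L, pd1 ζ x ^ 2)
            + ∫ x in Noz L, (pd1 ζ x ^ 2 + pd2 ζ x ^ 2
              + ω x ^ 2 + pd1 ω x ^ 2 + pd2 ω x ^ 2)) := by gcongr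
      _ = ∫ x in Noz L, ν₃ * (L ^ 2 * pd1 ζ x ^ 2 + (pd1 ζ x ^ 2 + pd2 ζ x ^ 2
              + ω x ^ 2 + pd1 ω x ^ 2 + pd2 ω x ^ 2)) := by
          rw [integral_const_mul, integral_add (hip.const_mul _) hirest, integral_const_mul]
      _ ≤ _ := by
          refine setIntegral_mono_on (((hip.const_mul _).add hirest).const_mul _) hmid
            (measurableSet_Noz L) fun x _ => ?_
          nlinarith [mul_le_mul_of_nonneg_right hν₃3 (sq_nonneg (pd1 ζ x)),
            mul_le_mul_of_nonneg_right hν₃3 (sq_nonneg (pd2 ζ x)),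
            mul_le_mul_of_nonneg_right hν₃1 (sq_nonneg (pd1 ω x)),
            mul_le_mul_of_nonneg_right hν₃1 (sq_nonneg (pd2 ω x)),
            mul_le_mul_of_nonneg_right hν₃2 (sq_nonneg (ω x)),
            mul_nonneg (mul_nonneg hν₃ (sq_nonneg L)) (sq_nonneg (pd2 ζ x))]
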